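/- arXiv:1807.03263 — 3 statements merged into one kernel-verified Lean document; each statement's English description precedes it below -/
import Mathlib

section
/- For every integer N ≥ 1, the batch gain formula equals the Riccati-based finite-horizon LQR gain: [R + M^T Ψ_N^{-1} M]^{-1} M^T Ψ_N^{-1} O_N^+ = (R + B^T P_{N−1} B)^{-1} B^T P_{N−1} A, where Ψ_N = Q_N^{-1} + S_N R_N^{-1} S_N^T, M = O_N B (the stacked Markov parameters [CB; CAB; …; CA^{N−1}B]), and O_N^+ = O_N A (the stacked matrix [CA; CA^2; …; CA^N]). -/
open Matrix

/-- Extended observability matrix `O_N` with `i`-th block row `C * A ^ i` (0-based). -/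
def obsMat {n q : ℕ} (A : Matrix (Fin n) (Fin n) ℝ) (C : Matrix (Fin q) (Fin n) ℝ)
    (N : ℕ) : Matrix (Fin N × Fin q) (Fin n) ℝ :=
  fun ia j => (C * A ^ (ia.1 : ℕ)) ia.2 j

/-- Block lower-triangular Toeplitz matrix `S_N` of Markov parameters: block `(i,j)` equals
`C * A ^ (i - j - 1) * B` for `i > j` (0-based), and `0` otherwise. -/
def toepMat {n p q : ℕ} (A : Matrix (Fin n) (Fin n) ℝ) (B : Matrix (Fin n) (Fin p) ℝ)
    (C : Matrix (Fin q) (Fin n) ℝ) (N : ℕ) : Matrix (Fin N × Fin q) (Fin N × Fin p) ℝ :=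
  fun ia jb =>
    if (jb.1 : ℕ) < (ia.1 : ℕ) then
      (C * A ^ ((ia.1 : ℕ) - (jb.1 : ℕ) - 1) * B) ia.2 jb.2
    else 0

/-- Block diagonal matrix `diag(Q, …, Q)` with `N` diagonal blocks. -/
def blkDiag {q : ℕ} (Q : Matrix (Fin q) (Fin q) ℝ) (N : ℕ) :
    Matrix (Fin N × Fin q) (Fin N × Fin q) ℝ :=
  fun ia jb => if ia.1 = jb.1 then Q ia.2 jb.2 else 0

open scoped Kronecker

/-- Splits off the first block of an index set of `N + 1` blocks. -/
def blockSuccEquiv (q N : ℕ) : Fin q ⊕ Fin N × Fin q ≃ Fin (N + 1) × Fin q where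
  toFun := Sum.elim (fun a => (0, a)) (fun ia => (ia.1.succ, ia.2))
  invFun ia := Fin.cases (Sum.inl ia.2) (fun i => Sum.inr (i, ia.2)) ia.1
  left_inv x := by rcases x with a | ⟨i, a⟩ <;> rfl
  right_inv x := by
    obtain ⟨i, a⟩ := x
    cases i using Fin.cases <;> rfl

theorem blkDiag_eq_kronecker {q : ℕ} (Q : Matrix (Fin q) (Fin q) ℝ) (N : ℕ) :
    blkDiag Q N = (1 : Matrix (Fin N) (Fin N) ℝ) ⊗ₖ Q := by
  ext ⟨i, a⟩ ⟨j, b⟩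
  simp [blkDiag, kroneckerMap_apply, Matrix.one_apply]

theorem blkDiag_inv {q : ℕ} (Q : Matrix (Fin q) (Fin q) ℝ) (N : ℕ) :
    (blkDiag Q N)⁻¹ = blkDiag Q⁻¹ N := by
  rw [blkDiag_eq_kronecker, blkDiag_eq_kronecker, inv_kronecker, inv_one]

theorem blkDiag_posDef {q : ℕ} {Q : Matrix (Fin q) (Fin q) ℝ} (hQ : Q.PosDef) (N : ℕ) :
    (blkDiag Q N).PosDef := by
  rw [blkDiag_eq_kronecker]
  exact PosDef.one.kronecker hQ

theorem blkDiag_succ {q : ℕ} (Q : Matrix (Fin q) (Fin q) ℝ) (N : ℕ) :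
    (blkDiag Q (N + 1)).submatrix (blockSuccEquiv q N) (blockSuccEquiv q N) =
      fromBlocks Q 0 0 (blkDiag Q N) := by
  ext (a | ⟨i, a⟩) (b | ⟨j, b⟩) <;>
    simp [blkDiag, blockSuccEquiv, Fin.succ_ne_zero, (Fin.succ_ne_zero _).symm]

theorem obsMat_succ {n q : ℕ} (A : Matrix (Fin n) (Fin n) ℝ) (C : Matrix (Fin q) (Fin n) ℝ)
    (N : ℕ) :
    (obsMat A C (N + 1)).submatrix (blockSuccEquiv q N) id = fromRows C (obsMat A C N * A) := by
  ext (a | ⟨i, a⟩) j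
  · simp [obsMat, blockSuccEquiv]
  · simp only [obsMat, blockSuccEquiv, submatrix_apply, Equiv.coe_fn_mk, Sum.elim_inr,
      Fin.val_succ, id, pow_succ, fromRows_apply_inr, ← Matrix.mul_assoc]
    rfl

theorem toepMat_succ {n p q : ℕ} (A : Matrix (Fin n) (Fin n) ℝ) (B : Matrix (Fin n) (Fin p) ℝ)
    (C : Matrix (Fin q) (Fin n) ℝ) (N : ℕ) :
    (toepMat A B C (N + 1)).submatrix (blockSuccEquiv q N) (blockSuccEquiv p N) =
      fromBlocks 0 0 (obsMat A C N * B) (toepMat A B C N) := by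
  ext (a | ⟨i, a⟩) (b | ⟨j, b⟩)
  · simp [toepMat, blockSuccEquiv]
  · simp [toepMat, blockSuccEquiv]
  · simp [toepMat, blockSuccEquiv, obsMat, Matrix.mul_apply]
  · simp [toepMat, blockSuccEquiv]

/-- The weight `Ψ_N = Q_N⁻¹ + S_N R_N⁻¹ S_Nᵀ` of the batch problem. -/
noncomputable def batchWeight {n p q : ℕ} (A : Matrix (Fin n) (Fin n) ℝ)
    (B : Matrix (Fin n) (Fin p) ℝ) (C : Matrix (Fin q) (Fin n) ℝ)
    (Q : Matrix (Fin q) (Fin q) ℝ) (R : Matrix (Fin p) (Fin p) ℝ) (N : ℕ) :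
    Matrix (Fin N × Fin q) (Fin N × Fin q) ℝ :=
  (blkDiag Q N)⁻¹ + toepMat A B C N * (blkDiag R N)⁻¹ * (toepMat A B C N)ᵀ

theorem batchWeight_posDef {n p q : ℕ} (A : Matrix (Fin n) (Fin n) ℝ)
    (B : Matrix (Fin n) (Fin p) ℝ) (C : Matrix (Fin q) (Fin n) ℝ)
    {Q : Matrix (Fin q) (Fin q) ℝ} {R : Matrix (Fin p) (Fin p) ℝ}
    (hQ : Q.PosDef) (hR : R.PosDef) (N : ℕ) : (batchWeight A B C Q R N).PosDef := by
  have h := (blkDiag_posDef hR N).inv.posSemidef.mul_mul_conjTranspose_same (toepMat A B C N)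
  rw [conjTranspose_eq_transpose_of_trivial] at h
  exact (blkDiag_posDef hQ N).inv.add_posSemidef h

theorem batchWeight_succ {n p q : ℕ} (A : Matrix (Fin n) (Fin n) ℝ)
    (B : Matrix (Fin n) (Fin p) ℝ) (C : Matrix (Fin q) (Fin n) ℝ)
    (Q : Matrix (Fin q) (Fin q) ℝ) (R : Matrix (Fin p) (Fin p) ℝ) (N : ℕ) :
    (batchWeight A B C Q R (N + 1)).submatrix (blockSuccEquiv q N) (blockSuccEquiv q N) =
      fromBlocks Q⁻¹ 0 0
        (batchWeight A B C Q R N + obsMat A C N * B * R⁻¹ * (obsMat A C N * B)ᵀ) := by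
  rw [batchWeight, submatrix_add, Pi.add_apply, Pi.add_apply, blkDiag_inv, blkDiag_inv,
    blkDiag_succ, ← submatrix_mul_equiv _ _ _ (blockSuccEquiv p N),
    ← submatrix_mul_equiv _ _ _ (blockSuccEquiv p N), ← transpose_submatrix, toepMat_succ,
    blkDiag_succ, fromBlocks_transpose, fromBlocks_multiply, fromBlocks_multiply,
    fromBlocks_add, batchWeight, blkDiag_inv, blkDiag_inv]
  congr 1 <;> simp
  abel

/-- The batch cost-to-go matrix `O_Nᵀ Ψ_N⁻¹ O_N`. -/
noncomputable def batchCost {n p q : ℕ} (A : Matrix (Fin n) (Fin n) ℝ)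
    (B : Matrix (Fin n) (Fin p) ℝ) (C : Matrix (Fin q) (Fin n) ℝ)
    (Q : Matrix (Fin q) (Fin q) ℝ) (R : Matrix (Fin p) (Fin p) ℝ) (N : ℕ) :
    Matrix (Fin n) (Fin n) ℝ :=
  (obsMat A C N)ᵀ * (batchWeight A B C Q R N)⁻¹ * obsMat A C N

theorem batchCost_zero {n p q : ℕ} (A : Matrix (Fin n) (Fin n) ℝ)
    (B : Matrix (Fin n) (Fin p) ℝ) (C : Matrix (Fin q) (Fin n) ℝ)
    (Q : Matrix (Fin q) (Fin q) ℝ) (R : Matrix (Fin p) (Fin p) ℝ) :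
    batchCost A B C Q R 0 = 0 := by
  ext i j
  simp [batchCost, Matrix.mul_apply]

theorem batchCost_posSemidef {n p q : ℕ} (A : Matrix (Fin n) (Fin n) ℝ)
    (B : Matrix (Fin n) (Fin p) ℝ) (C : Matrix (Fin q) (Fin n) ℝ)
    {Q : Matrix (Fin q) (Fin q) ℝ} {R : Matrix (Fin p) (Fin p) ℝ}
    (hQ : Q.PosDef) (hR : R.PosDef) (N : ℕ) : (batchCost A B C Q R N).PosSemidef := by
  have h := (batchWeight_posDef A B C hQ hR N).inv.posSemidef.conjTranspose_mul_mul_same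
    (obsMat A C N)
  rwa [conjTranspose_eq_transpose_of_trivial] at h

/-- The batch cost-to-go matrices satisfy the Riccati recursion. -/
theorem batchCost_succ {n p q : ℕ} (A : Matrix (Fin n) (Fin n) ℝ)
    (B : Matrix (Fin n) (Fin p) ℝ) (C : Matrix (Fin q) (Fin n) ℝ)
    {Q : Matrix (Fin q) (Fin q) ℝ} {R : Matrix (Fin p) (Fin p) ℝ}
    (hQ : Q.PosDef) (hR : R.PosDef) (N : ℕ) :
    batchCost A B C Q R (N + 1) =
      Aᵀ * batchCost A B C Q R N * A -
        (Aᵀ * batchCost A B C Q R N * B) * (R + Bᵀ * batchCost A B C Q R N * B)⁻¹ *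
          (Bᵀ * batchCost A B C Q R N * A) + Cᵀ * Q * C := by
  have hΨ := batchWeight_posDef A B C hQ hR N
  have hgain : (R + Bᵀ * batchCost A B C Q R N * B).PosDef := by
    have h := (batchCost_posSemidef A B C hQ hR N).conjTranspose_mul_mul_same B
    rw [conjTranspose_eq_transpose_of_trivial] at h
    exact hR.add_posSemidef h
  have hM : (obsMat A C N * B)ᵀ * (batchWeight A B C Q R N)⁻¹ * (obsMat A C N * B) =
      Bᵀ * batchCost A B C Q R N * B := by
    simp only [batchCost, transpose_mul, Matrix.mul_assoc]
  have hW : IsUnit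
      (batchWeight A B C Q R N + obsMat A C N * B * R⁻¹ * (obsMat A C N * B)ᵀ) := by
    have h := hR.inv.posSemidef.mul_mul_conjTranspose_same (obsMat A C N * B)
    rw [conjTranspose_eq_transpose_of_trivial] at h
    exact (hΨ.add_posSemidef h).isUnit
  have hRinv : R⁻¹⁻¹ = R := nonsing_inv_nonsing_inv _ ((isUnit_iff_isUnit_det _).1 hR.isUnit)
  have hQinv : Q⁻¹⁻¹ = Q := nonsing_inv_nonsing_inv _ ((isUnit_iff_isUnit_det _).1 hQ.isUnit)
  have hsplit : batchCost A B C Q R (N + 1) =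
      ((obsMat A C (N + 1)).submatrix (blockSuccEquiv q N) id)ᵀ *
        ((batchWeight A B C Q R (N + 1)).submatrix
          (blockSuccEquiv q N) (blockSuccEquiv q N))⁻¹ *
        (obsMat A C (N + 1)).submatrix (blockSuccEquiv q N) id := by
    rw [inv_submatrix_equiv, transpose_submatrix, submatrix_mul_equiv, submatrix_mul_equiv,
      submatrix_id_id, batchCost]
  rw [hsplit, batchWeight_succ, obsMat_succ,
    inv_fromBlocks_zero₂₁_of_isUnit_iff _ _ _ (iff_of_true hQ.inv.isUnit hW), hQinv,
    add_mul_mul_inv_eq_sub _ _ _ _ hΨ.isUnit hR.inv.isUnit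
      (by rw [hRinv, hM]; exact hgain.isUnit),
    hRinv, hM, transpose_fromRows, fromCols_mul_fromBlocks, fromCols_mul_fromRows]
  generalize (R + Bᵀ * batchCost A B C Q R N * B)⁻¹ = G
  simp only [batchCost, transpose_mul, Matrix.mul_assoc, Matrix.mul_sub, Matrix.sub_mul,
    Matrix.add_mul, Matrix.mul_zero, Matrix.zero_mul, Matrix.mul_neg, Matrix.neg_mul,
    add_zero]
  abel

theorem riccati_eq_batchCost {n p q : ℕ} (A : Matrix (Fin n) (Fin n) ℝ)
    (B : Matrix (Fin n) (Fin p) ℝ) (C : Matrix (Fin q) (Fin n) ℝ)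
    {Q : Matrix (Fin q) (Fin q) ℝ} {R : Matrix (Fin p) (Fin p) ℝ}
    (hQ : Q.PosDef) (hR : R.PosDef) (P : ℕ → Matrix (Fin n) (Fin n) ℝ)
    (hP0 : P 0 = Cᵀ * Q * C)
    (hPrec : ∀ j, P (j + 1) =
      Aᵀ * P j * A - (Aᵀ * P j * B) * (R + Bᵀ * P j * B)⁻¹ * (Bᵀ * P j * A) + Cᵀ * Q * C)
    (j : ℕ) : P j = batchCost A B C Q R (j + 1) := by
  induction j with
  | zero => simp [batchCost_succ A B C hQ hR, batchCost_zero, hP0]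
  | succ j ih => rw [hPrec, batchCost_succ A B C hQ hR (j + 1), ih]

/-- The batch gain formula equals the Riccati-based finite-horizon LQR gain:
`[R + Mᵀ Ψ_N⁻¹ M]⁻¹ Mᵀ Ψ_N⁻¹ O_N⁺ = (R + Bᵀ P_{N-1} B)⁻¹ Bᵀ P_{N-1} A`,
where `Ψ_N = Q_N⁻¹ + S_N R_N⁻¹ S_Nᵀ`, `M = O_N B` and `O_N⁺ = O_N A`. -/
theorem batch_gain_eq_riccati_gain {n p q : ℕ}
    (A : Matrix (Fin n) (Fin n) ℝ) (B : Matrix (Fin n) (Fin p) ℝ)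
    (C : Matrix (Fin q) (Fin n) ℝ)
    (Q : Matrix (Fin q) (Fin q) ℝ) (R : Matrix (Fin p) (Fin p) ℝ)
    (hQ : Q.PosDef) (hR : R.PosDef)
    (P : ℕ → Matrix (Fin n) (Fin n) ℝ)
    (hP0 : P 0 = Cᵀ * Q * C)
    (hPrec : ∀ j, P (j + 1) =
      Aᵀ * P j * A - (Aᵀ * P j * B) * (R + Bᵀ * P j * B)⁻¹ * (Bᵀ * P j * A) + Cᵀ * Q * C)
    (N : ℕ) (hN : 1 ≤ N) :
    (R + (obsMat A C N * B)ᵀ *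
          ((blkDiag Q N)⁻¹ + toepMat A B C N * (blkDiag R N)⁻¹ * (toepMat A B C N)ᵀ)⁻¹ *
          (obsMat A C N * B))⁻¹ *
        ((obsMat A C N * B)ᵀ *
          ((blkDiag Q N)⁻¹ + toepMat A B C N * (blkDiag R N)⁻¹ * (toepMat A B C N)ᵀ)⁻¹ *
          (obsMat A C N * A)) =
      (R + Bᵀ * P (N - 1) * B)⁻¹ * (Bᵀ * P (N - 1) * A) := by
  obtain ⟨N, rfl⟩ := Nat.exists_eq_add_of_le' hN
  rw [Nat.add_sub_cancel, riccati_eq_batchCost A B C hQ hR P hP0 hPrec N]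
  simp only [batchCost, batchWeight, transpose_mul, Matrix.mul_assoc]
end

section
/- Let u, y, x satisfy x(k+1) = A x(k) + B u(k), y(k) = C x(k) for all k, let F ∈ R^{n×qN} satisfy A^N + F O_N = 0, and set W = [O_N(C_N + F S_N) −O_N F S_N] and Φ = [U_p; Y_p; U_f]. If Φ Φ^T is invertible, then the least-squares estimate recovers W exactly: Y_f Φ^T (Φ Φ^T)^{-1} = W; in particular the rightmost pN columns of the estimate equal the Markov-parameter Toeplitz matrix S_N. -/
open Matrix

/-- Extended controllability-type matrix `C_N = [A^{N-1}B ⋯ AB B]`. -/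
def ctrlMat {n p : ℕ} (A : Matrix (Fin n) (Fin n) ℝ) (B : Matrix (Fin n) (Fin p) ℝ)
    (N : ℕ) : Matrix (Fin n) (Fin N × Fin p) ℝ :=
  fun i jb => (A ^ (N - 1 - (jb.1 : ℕ)) * B) i jb.2

/-- Block Hankel matrix of a signal `e`, starting at time `k`, with `N` block rows and `L`
columns: its block `(i,j)` (0-based) is `e (k + i + j)`. -/
def hankelMat {d : ℕ} (e : ℕ → Fin d → ℝ) (k N L : ℕ) : Matrix (Fin N × Fin d) (Fin L) ℝ :=
  fun ia j => e (k + (ia.1 : ℕ) + (j : ℕ)) ia.2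

/-- Row index type of the stacked regressor `Φ = [U_p; Y_p; U_f]`. -/
abbrev RegIdx (N p q : ℕ) := (Fin N × Fin p) ⊕ ((Fin N × Fin q) ⊕ (Fin N × Fin p))

/-- Variation of constants: the state `m` steps ahead in terms of the current state and inputs. -/
theorem state_add {n p : ℕ} {A : Matrix (Fin n) (Fin n) ℝ} {B : Matrix (Fin n) (Fin p) ℝ}
    {x : ℕ → Fin n → ℝ} {u : ℕ → Fin p → ℝ}
    (hdyn : ∀ k, x (k + 1) = A.mulVec (x k) + B.mulVec (u k)) (k m : ℕ) :
    x (k + m) = (A ^ m).mulVec (x k) +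
      ∑ l ∈ Finset.range m, (A ^ (m - 1 - l) * B).mulVec (u (k + l)) := by
  induction m with
  | zero => simp
  | succ m ih =>
    rw [← add_assoc, hdyn, ih, Finset.sum_range_succ, mulVec_add, mulVec_mulVec, ← pow_succ',
      mulVec_sum, add_assoc]
    congr 2
    · refine Finset.sum_congr rfl fun l hl => ?_
      have hl' := Finset.mem_range.mp hl
      rw [mulVec_mulVec, ← Matrix.mul_assoc, ← pow_succ',
        show m - 1 - l + 1 = m + 1 - 1 - l by omega]
    · simp

/-- The matrix whose columns are the `L` consecutive values of a signal starting at time `k`. -/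
def signalMat {d : ℕ} (e : ℕ → Fin d → ℝ) (k L : ℕ) : Matrix (Fin d) (Fin L) ℝ :=
  fun i j => e (k + (j : ℕ)) i

theorem signalMat_add {n p : ℕ} {A : Matrix (Fin n) (Fin n) ℝ} {B : Matrix (Fin n) (Fin p) ℝ}
    {x : ℕ → Fin n → ℝ} {u : ℕ → Fin p → ℝ}
    (hdyn : ∀ k, x (k + 1) = A.mulVec (x k) + B.mulVec (u k)) (k N L : ℕ) :
    signalMat x (k + N) L = A ^ N * signalMat x k L + ctrlMat A B N * hankelMat u k N L := by
  ext i j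
  have h := congrFun (state_add hdyn (k + j) N) i
  rw [Finset.sum_range, Pi.add_apply, Finset.sum_apply] at h
  rw [Matrix.add_apply, Matrix.mul_apply, Matrix.mul_apply, Fintype.sum_prod_type]
  simp only [signalMat, ctrlMat, hankelMat]
  simp only [add_right_comm k _ (j : ℕ)]
  rw [add_right_comm] at h
  rw [add_right_comm, h]
  rfl

theorem hankelMat_output {n p q : ℕ} {A : Matrix (Fin n) (Fin n) ℝ}
    {B : Matrix (Fin n) (Fin p) ℝ} {C : Matrix (Fin q) (Fin n) ℝ}
    {x : ℕ → Fin n → ℝ} {u : ℕ → Fin p → ℝ} {y : ℕ → Fin q → ℝ}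
    (hdyn : ∀ k, x (k + 1) = A.mulVec (x k) + B.mulVec (u k))
    (hout : ∀ k, y k = C.mulVec (x k)) (k N L : ℕ) :
    hankelMat y k N L =
      obsMat A C N * signalMat x k L + toepMat A B C N * hankelMat u k N L := by
  ext ⟨i, a⟩ j
  have h : y (k + j + i) a = (C * A ^ (i : ℕ)).mulVec (x (k + j)) a +
      ∑ l : Fin N, if (l : ℕ) < i then
        (C * A ^ ((i : ℕ) - l - 1) * B).mulVec (u (k + j + l)) a else 0 := by
    rw [hout, state_add hdyn, mulVec_add, mulVec_mulVec, mulVec_sum, Pi.add_apply,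
      Finset.sum_apply, ← Finset.sum_range fun l => if l < (i : ℕ) then
        (C * A ^ ((i : ℕ) - l - 1) * B).mulVec (u (k + j + l)) a else 0,
      ← Finset.sum_filter]
    congr 1
    refine Finset.sum_congr ?_ fun l _ => ?_
    · ext l
      have := i.isLt
      simp only [Finset.mem_range, Finset.mem_filter]
      omega
    · rw [mulVec_mulVec, ← Matrix.mul_assoc, Nat.sub_right_comm]
  rw [Matrix.add_apply, Matrix.mul_apply, Matrix.mul_apply, Fintype.sum_prod_type]
  simp only [signalMat, obsMat, toepMat, hankelMat]
  simp only [add_right_comm k _ (j : ℕ)]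
  rw [h]
  congr 1
  refine Finset.sum_congr rfl fun l _ => ?_
  split_ifs <;> simp [mulVec, dotProduct]

/-- In the noise-free case the least-squares estimate `Y_f Φᵀ (Φ Φᵀ)⁻¹` recovers
`W = [O_N(C_N + F S_N)  -O_N F  S_N]` exactly; in particular, its rightmost `pN`
columns equal the Markov-parameter Toeplitz matrix `S_N`. -/
theorem least_squares_recovers_W {n p q : ℕ}
    (A : Matrix (Fin n) (Fin n) ℝ) (B : Matrix (Fin n) (Fin p) ℝ)
    (C : Matrix (Fin q) (Fin n) ℝ)
    (x : ℕ → Fin n → ℝ) (u : ℕ → Fin p → ℝ) (y : ℕ → Fin q → ℝ)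
    (hdyn : ∀ k, x (k + 1) = A.mulVec (x k) + B.mulVec (u k))
    (hout : ∀ k, y k = C.mulVec (x k))
    (N L : ℕ) (hN : 1 ≤ N) (hL : 1 ≤ L)
    (F : Matrix (Fin n) (Fin N × Fin q) ℝ)
    (hF : A ^ N + F * obsMat A C N = 0)
    (Φ : Matrix (RegIdx N p q) (Fin L) ℝ)
    (hΦ : Φ = Matrix.of fun i j =>
      Sum.elim (fun a => hankelMat u 0 N L a j)
        (Sum.elim (fun b => hankelMat y 0 N L b j) (fun c => hankelMat u N N L c j)) i)
    (W : Matrix (Fin N × Fin q) (RegIdx N p q) ℝ)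
    (hW : W = Matrix.of fun i j =>
      Sum.elim (fun a => (obsMat A C N * (ctrlMat A B N + F * toepMat A B C N)) i a)
        (Sum.elim (fun b => (-(obsMat A C N * F)) i b) (fun c => toepMat A B C N i c)) j)
    (hinv : IsUnit (Φ * Φᵀ).det) :
    hankelMat y N N L * Φᵀ * (Φ * Φᵀ)⁻¹ = W ∧
      ∀ (i : Fin N × Fin q) (c : Fin N × Fin p),
        (hankelMat y N N L * Φᵀ * (Φ * Φᵀ)⁻¹) i (Sum.inr (Sum.inr c)) =
          toepMat A B C N i c := by
  have hY : hankelMat y N N L = W * Φ := by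
    have hWΦ : W * Φ = obsMat A C N * (ctrlMat A B N + F * toepMat A B C N) * hankelMat u 0 N L +
        (-(obsMat A C N * F) * hankelMat y 0 N L + toepMat A B C N * hankelMat u N N L) := by
      ext i j
      simp only [hW, hΦ, Matrix.mul_apply, Matrix.add_apply, Fintype.sum_sum_type, Matrix.of_apply,
        Sum.elim_inl, Sum.elim_inr]
    have hX := signalMat_add hdyn 0 N L
    rw [zero_add, eq_neg_of_add_eq_zero_left hF] at hX
    rw [hWΦ, hankelMat_output hdyn hout N, hankelMat_output hdyn hout 0, hX]
    simp only [Matrix.mul_add, Matrix.add_mul, Matrix.neg_mul, Matrix.mul_neg, Matrix.mul_assoc]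
    abel
  have hmain : hankelMat y N N L * Φᵀ * (Φ * Φᵀ)⁻¹ = W := by
    rw [hY, Matrix.mul_assoc W, Matrix.mul_nonsing_inv_cancel_right _ _ hinv]
  refine ⟨hmain, fun i c => ?_⟩
  rw [hmain, hW]
  rfl
end

section
/- (Exactness of Algorithm 2 in the noise-free case.) Let u, y, x satisfy x(k+1) = A x(k) + B u(k), y(k) = C x(k) for all k, suppose U_p U_p^T is invertible, set U_po = I_L − U_p^T (U_p U_p^T)^{-1} U_p, and suppose (X U_po)(X U_po)^T is invertible. Then the estimator of Algorithm 2 recovers the extended observability matrix exactly: (Y_p U_po)(X U_po)^T ((X U_po)(X U_po)^T)^{-1} = O_N. -/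
open Matrix

/-- State data matrix `X = [x(0) x(1) ⋯ x(L-1)]`. -/
def stateMat {n : ℕ} (x : ℕ → Fin n → ℝ) (L : ℕ) : Matrix (Fin n) (Fin L) ℝ :=
  fun i j => x (j : ℕ) i

/-- Block lower-triangular Toeplitz matrix of the Markov parameters, with block `(i,j)` equal to
`C * A ^ (i - j - 1) * B` for `j < i` and `0` otherwise. -/
def toeplitzMat {n p q : ℕ} (A : Matrix (Fin n) (Fin n) ℝ) (B : Matrix (Fin n) (Fin p) ℝ)
    (C : Matrix (Fin q) (Fin n) ℝ) (N : ℕ) : Matrix (Fin N × Fin q) (Fin N × Fin p) ℝ :=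
  fun ia jb => if (jb.1 : ℕ) < ia.1
    then (C * A ^ ((ia.1 : ℕ) - 1 - (jb.1 : ℕ)) * B) ia.2 jb.2 else 0

theorem state_add_eq {n p : ℕ} {A : Matrix (Fin n) (Fin n) ℝ} {B : Matrix (Fin n) (Fin p) ℝ}
    {x : ℕ → Fin n → ℝ} {u : ℕ → Fin p → ℝ}
    (hdyn : ∀ k, x (k + 1) = A.mulVec (x k) + B.mulVec (u k)) (k i : ℕ) :
    x (i + k) = (A ^ i).mulVec (x k) +
      ∑ m ∈ Finset.range i, (A ^ (i - 1 - m) * B).mulVec (u (m + k)) := by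
  induction i with
  | zero => simp
  | succ i ih =>
    rw [Nat.add_right_comm, hdyn, ih, Finset.sum_range_succ, mulVec_add, mulVec_mulVec,
      ← pow_succ', mulVec_sum, add_assoc]
    congr 2
    · refine Finset.sum_congr rfl fun m hm => ?_
      have hm := Finset.mem_range.mp hm
      rw [mulVec_mulVec, ← Matrix.mul_assoc, ← pow_succ']
      congr 3
      omega
    · simp

theorem hankelMat_output_eq {n p q : ℕ} {A : Matrix (Fin n) (Fin n) ℝ}
    {B : Matrix (Fin n) (Fin p) ℝ} {C : Matrix (Fin q) (Fin n) ℝ}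
    {x : ℕ → Fin n → ℝ} {u : ℕ → Fin p → ℝ} {y : ℕ → Fin q → ℝ}
    (hdyn : ∀ k, x (k + 1) = A.mulVec (x k) + B.mulVec (u k))
    (hout : ∀ k, y k = C.mulVec (x k)) (N L : ℕ) :
    hankelMat y 0 N L =
      obsMat A C N * stateMat x L + toeplitzMat A B C N * hankelMat u 0 N L := by
  ext ⟨i, a⟩ j
  have hsum : (toeplitzMat A B C N * hankelMat u 0 N L) (i, a) j =
      ∑ m ∈ Finset.range i, (C * A ^ ((i : ℕ) - 1 - m) * B).mulVec (u (m + j)) a := by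
    rw [mul_apply]
    simp only [Fintype.sum_prod_type, toeplitzMat, hankelMat, zero_add, ite_mul,
      zero_mul]
    rw [Fin.sum_univ_eq_sum_range (fun m => ∑ b, if m < (i : ℕ)
      then (C * A ^ ((i : ℕ) - 1 - m) * B) a b * u (m + j) b else 0) N]
    rw [← Finset.sum_subset (Finset.range_subset_range.mpr i.isLt.le)]
    · refine Finset.sum_congr rfl fun m hm => ?_
      simp [Finset.mem_range.mp hm, mulVec, dotProduct]
    · intro m _ hm
      simp [Finset.mem_range.not.mp hm]
  rw [Matrix.add_apply, hsum]
  change y (0 + i + j) a = (C * A ^ (i : ℕ)).mulVec (x j) a + _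
  rw [zero_add, hout, state_add_eq hdyn, mulVec_add, mulVec_sum, mulVec_mulVec]
  simp [Finset.sum_apply, mulVec_mulVec, Matrix.mul_assoc]

theorem mul_one_sub_rowProjection {m l : Type*} [Fintype m] [DecidableEq m] [Fintype l]
    [DecidableEq l] (U : Matrix m l ℝ) (hU : IsUnit (U * Uᵀ).det) :
    U * (1 - Uᵀ * (U * Uᵀ)⁻¹ * U) = 0 := by
  rw [Matrix.mul_sub, Matrix.mul_one, ← Matrix.mul_assoc, ← Matrix.mul_assoc,
    mul_nonsing_inv _ hU, Matrix.one_mul, sub_self]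

/-- Exactness of Algorithm 2 in the noise-free case: with
`U_po = I_L - U_pᵀ (U_p U_pᵀ)⁻¹ U_p`, we have
`(Y_p U_po)(X U_po)ᵀ ((X U_po)(X U_po)ᵀ)⁻¹ = O_N`. -/
theorem algorithm2_exact_noise_free {n p q : ℕ}
    (A : Matrix (Fin n) (Fin n) ℝ) (B : Matrix (Fin n) (Fin p) ℝ)
    (C : Matrix (Fin q) (Fin n) ℝ)
    (x : ℕ → Fin n → ℝ) (u : ℕ → Fin p → ℝ) (y : ℕ → Fin q → ℝ)
    (hdyn : ∀ k, x (k + 1) = A.mulVec (x k) + B.mulVec (u k))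
    (hout : ∀ k, y k = C.mulVec (x k))
    (N L : ℕ) (hN : 1 ≤ N) (hL : 1 ≤ L)
    (hU : IsUnit (hankelMat u 0 N L * (hankelMat u 0 N L)ᵀ).det)
    (Upo : Matrix (Fin L) (Fin L) ℝ)
    (hUpo : Upo = 1 - (hankelMat u 0 N L)ᵀ *
      (hankelMat u 0 N L * (hankelMat u 0 N L)ᵀ)⁻¹ * hankelMat u 0 N L)
    (hXU : IsUnit ((stateMat x L * Upo) * (stateMat x L * Upo)ᵀ).det) :
    (hankelMat y 0 N L * Upo) * (stateMat x L * Upo)ᵀ *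
        ((stateMat x L * Upo) * (stateMat x L * Upo)ᵀ)⁻¹ = obsMat A C N := by
  have hUU : hankelMat u 0 N L * Upo = 0 := hUpo ▸ mul_one_sub_rowProjection _ hU
  rw [hankelMat_output_eq hdyn hout, Matrix.add_mul, Matrix.mul_assoc (toeplitzMat A B C N), hUU,
    Matrix.mul_zero, add_zero, Matrix.mul_assoc (obsMat A C N), Matrix.mul_assoc (obsMat A C N),
    Matrix.mul_assoc (obsMat A C N), mul_nonsing_inv _ hXU, Matrix.mul_one]
end
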